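/- Let G1 = (V1, E1) and G2 = (V2, E2) be rigidity circuits with e ∈ E1 ∩ E2, and suppose their common part (V1 ∩ V2, E1 ∩ E2) is a Laman graph on vertex set V1 ∩ V2. Then the combinatorial resultant H = CRes(G1, G2, e) is a Laman-plus-one graph: H has exactly 2|V1 ∪ V2| − 2 edges and there exists an edge f of H such that (V1 ∪ V2, E(H) \ {f}) is a Laman graph on vertex set V1 ∪ V2. -/

import Mathlib

open scoped Classical

noncomputable section

/-- The set of edges of `E` with both endpoints in `V'`. -/
def spans (E : Finset (Sym2 ℕ)) (V' : Finset ℕ) : Finset (Sym2 ℕ) :=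
  E.filter (fun e => ∀ v ∈ e, v ∈ V')

/-- `(V, E)` is a simple graph: edges are non-loops with both endpoints in `V`. -/
def IsGraph (V : Finset ℕ) (E : Finset (Sym2 ℕ)) : Prop :=
  ∀ e ∈ E, ¬ e.IsDiag ∧ ∀ v ∈ e, v ∈ V

/-- A rigidity circuit: a simple graph with `|E| = 2|V| - 2` such that every proper
subset `V' ⊊ V` with `|V'| ≥ 2` spans at most `2|V'| - 3` edges. -/
def IsRigidityCircuit (V : Finset ℕ) (E : Finset (Sym2 ℕ)) : Prop :=
  IsGraph V E ∧ E.card = 2 * V.card - 2 ∧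
    ∀ V' ⊂ V, 2 ≤ V'.card → (spans E V').card ≤ 2 * V'.card - 3

/-- A Laman graph on vertex set `V`: a simple graph with `|V| ≥ 2`, exactly
`2|V| - 3` edges, in which every `V' ⊆ V` with `|V'| ≥ 2` spans at most `2|V'| - 3`
edges, and every vertex of `V` is incident to at least one edge. -/
def IsLaman (V : Finset ℕ) (E : Finset (Sym2 ℕ)) : Prop :=
  IsGraph V E ∧ 2 ≤ V.card ∧ E.card = 2 * V.card - 3 ∧
    (∀ V' ⊆ V, 2 ≤ V'.card → (spans E V').card ≤ 2 * V'.card - 3) ∧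
    ∀ v ∈ V, ∃ e ∈ E, v ∈ e

theorem mem_spans {E : Finset (Sym2 ℕ)} {V' : Finset ℕ} {e : Sym2 ℕ} :
    e ∈ spans E V' ↔ e ∈ E ∧ ∀ v ∈ e, v ∈ V' := by
  simp [spans]

theorem spans_subset_spans {E E' : Finset (Sym2 ℕ)} {V V' : Finset ℕ} (hE : E ⊆ E')
    (hV : V ⊆ V') : spans E V ⊆ spans E' V' := fun _ he =>
  mem_spans.2 ⟨hE (mem_spans.1 he).1, fun v hv => hV ((mem_spans.1 he).2 v hv)⟩

theorem IsGraph.mono {V V' : Finset ℕ} {E E' : Finset (Sym2 ℕ)} (h : IsGraph V E)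
    (hE : E' ⊆ E) (hV : V ⊆ V') : IsGraph V' E' := fun e he =>
  ⟨(h e (hE he)).1, fun v hv => hV ((h e (hE he)).2 v hv)⟩

theorem IsGraph.union {V V' : Finset ℕ} {E E' : Finset (Sym2 ℕ)} (h : IsGraph V E)
    (h' : IsGraph V' E') : IsGraph (V ∪ V') (E ∪ E') := fun e he =>
  (Finset.mem_union.1 he).elim
    (fun he => h.mono subset_rfl Finset.subset_union_left e he)
    (fun he => h'.mono subset_rfl Finset.subset_union_right e he)

theorem IsGraph.spans_inter {V : Finset ℕ} {E : Finset (Sym2 ℕ)} (h : IsGraph V E)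
    (V' : Finset ℕ) : spans E (V' ∩ V) = spans E V' := by
  refine (spans_subset_spans subset_rfl Finset.inter_subset_left).antisymm fun e he => ?_
  rw [mem_spans] at he ⊢
  exact ⟨he.1, fun v hv => Finset.mem_inter.2 ⟨he.2 v hv, (h e he.1).2 v hv⟩⟩

/-- A loopless graph spans no edges on at most one vertex. -/
theorem IsGraph.spans_eq_empty {V V' : Finset ℕ} {E : Finset (Sym2 ℕ)} (h : IsGraph V E)
    (hV' : V'.card ≤ 1) : spans E V' = ∅ := by
  refine Finset.eq_empty_of_forall_notMem fun e he => ?_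
  obtain ⟨heE, hev⟩ := mem_spans.1 he
  have hd := (h e heE).1
  induction e using Sym2.ind with
  | _ a b =>
    exact hd (Finset.card_le_one.1 hV' a (hev a (Sym2.mem_mk_left a b)) b
      (hev b (Sym2.mem_mk_right a b)))

/-- Deleting any edge from a rigidity circuit leaves a sparse graph. -/
theorem IsRigidityCircuit.card_spans_erase_le {V A : Finset ℕ} {E : Finset (Sym2 ℕ)}
    (h : IsRigidityCircuit V E) {f : Sym2 ℕ} (hf : f ∈ E) (hA : A ⊆ V) (hA2 : 2 ≤ A.card) :
    (spans (E.erase f) A).card ≤ 2 * A.card - 3 := by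
  obtain ⟨-, hcard, hsparse⟩ := h
  rcases hA.eq_or_ssubset with rfl | hlt
  · have h1 : (spans (E.erase f) A).card ≤ (E.erase f).card :=
      Finset.card_le_card (Finset.filter_subset _ _)
    rw [Finset.card_erase_of_mem hf] at h1
    omega
  · exact (Finset.card_le_card
      (spans_subset_spans (Finset.erase_subset _ _) subset_rfl)).trans (hsparse A hlt hA2)

/-- A sparse graph with `2|V| - 3` edges has no isolated vertices. -/
theorem isLaman_of_sparse {V : Finset ℕ} {E : Finset (Sym2 ℕ)} (h : IsGraph V E)
    (hV : 2 ≤ V.card) (hcard : E.card = 2 * V.card - 3)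
    (hsparse : ∀ V' ⊆ V, 2 ≤ V'.card → (spans E V').card ≤ 2 * V'.card - 3) :
    IsLaman V E := by
  refine ⟨h, hV, hcard, hsparse, fun v hv => ?_⟩
  by_contra! hiso
  have hE : spans E (V.erase v) = E := by
    refine Finset.filter_true_of_mem fun e he w hw => Finset.mem_erase.2 ⟨?_, (h e he).2 w hw⟩
    rintro rfl
    exact hiso e he hw
  have hc := Finset.card_erase_of_mem hv
  by_cases h2 : 2 ≤ (V.erase v).card
  · have := hsparse _ (Finset.erase_subset v V) h2
    rw [hE] at this
    omega
  · have := congrArg Finset.card (h.spans_eq_empty (V' := V.erase v) (by omega))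
    rw [hE, Finset.card_empty] at this
    omega

/-- If a circuit minus an edge `f` contains a Laman graph `C` on `W`, then the remaining edges
spanned by `A` number at most twice the vertices of `A` outside `W`. -/
theorem IsRigidityCircuit.card_spans_sdiff_le {V W A : Finset ℕ} {E C : Finset (Sym2 ℕ)}
    (h : IsRigidityCircuit V E) {f : Sym2 ℕ} (hf : f ∈ E) (hC : IsLaman W C) (hCE : C ⊆ E.erase f)
    (hWV : W ⊆ V) (hA : A ⊆ V) :
    (spans (E.erase f \ C) A).card ≤ 2 * (A \ W).card := by
  obtain ⟨hCg, hW2, hCcard, -⟩ := hC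
  have hdisj : Disjoint (spans (E.erase f \ C) A) C :=
    Finset.disjoint_left.2 fun x hx hxC =>
      (Finset.mem_sdiff.1 (mem_spans.1 hx).1).2 hxC
  have hsub : spans (E.erase f \ C) A ∪ C ⊆ spans (E.erase f) (A ∪ W) := by
    refine Finset.union_subset
      (spans_subset_spans Finset.sdiff_subset Finset.subset_union_left) fun x hx => ?_
    exact mem_spans.2 ⟨hCE hx, fun v hv => Finset.mem_union_right _ ((hCg x hx).2 v hv)⟩
  have hle := Finset.card_le_card hsub
  rw [Finset.card_union_of_disjoint hdisj] at hle
  have hW : W.card ≤ (A ∪ W).card := Finset.card_le_card Finset.subset_union_right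
  have hsp := h.card_spans_erase_le hf (Finset.union_subset hA hWV) (hW2.trans hW)
  have hAW := Finset.card_sdiff_add_card A W
  omega

/-- If two rigidity circuits share an edge `e` and their common part is a Laman graph,
then their combinatorial resultant is a Laman-plus-one graph. -/
theorem cres_of_circuits_with_laman_intersection (V1 V2 : Finset ℕ)
    (E1 E2 : Finset (Sym2 ℕ)) (e : Sym2 ℕ)
    (h1 : IsRigidityCircuit V1 E1) (h2 : IsRigidityCircuit V2 E2)
    (he : e ∈ E1 ∩ E2) (hcommon : IsLaman (V1 ∩ V2) (E1 ∩ E2)) :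
    ((E1 ∪ E2) \ {e}).card = 2 * (V1 ∪ V2).card - 2 ∧
      ∃ f ∈ (E1 ∪ E2) \ {e}, IsLaman (V1 ∪ V2) (((E1 ∪ E2) \ {e}) \ {f}) := by
  obtain ⟨he1, he2⟩ := Finset.mem_inter.1 he
  obtain ⟨hg1, hc1, -⟩ := id h1
  obtain ⟨hg2, hc2, -⟩ := id h2
  obtain ⟨-, hW2, hCcard, -⟩ := id hcommon
  have hV1 : (V1 ∩ V2).card ≤ V1.card := Finset.card_le_card Finset.inter_subset_left
  have hV2 : (V1 ∩ V2).card ≤ V2.card := Finset.card_le_card Finset.inter_subset_right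
  have hV := Finset.card_union_add_card_inter V1 V2
  have hE := Finset.card_union_add_card_inter E1 E2
  have hcard : ((E1 ∪ E2) \ {e}).card = 2 * (V1 ∪ V2).card - 2 := by
    rw [Finset.sdiff_singleton_eq_erase, Finset.card_erase_of_mem (Finset.mem_union_left _ he1)]
    omega
  refine ⟨hcard, ?_⟩
  obtain ⟨f, hf1, hfC⟩ := Finset.exists_mem_notMem_of_card_lt_card
    (show (E1 ∩ E2).card < E1.card by omega)
  have hf2 : f ∉ E2 := fun hf2 => hfC (Finset.mem_inter.2 ⟨hf1, hf2⟩)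
  have hfe : f ≠ e := fun h => hf2 (h ▸ he2)
  have hfmem : f ∈ (E1 ∪ E2) \ {e} := by simp [hf1, hfe]
  refine ⟨f, hfmem, ?_⟩
  have hgraph : IsGraph (V1 ∪ V2) (((E1 ∪ E2) \ {e}) \ {f}) :=
    (hg1.union hg2).mono (Finset.sdiff_subset.trans Finset.sdiff_subset) subset_rfl
  refine isLaman_of_sparse hgraph (by omega) ?_ fun V' hV' hV'2 => ?_
  · rw [Finset.sdiff_singleton_eq_erase, Finset.card_erase_of_mem hfmem, hcard]
    omega
  have hsplit : spans (((E1 ∪ E2) \ {e}) \ {f}) V' ⊆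
      spans (E2.erase e) (V' ∩ V2) ∪ spans (E1.erase f \ (E1 ∩ E2)) (V' ∩ V1) := by
    rw [(hg2.mono (Finset.erase_subset _ _) subset_rfl).spans_inter,
      (hg1.mono (Finset.sdiff_subset.trans (Finset.erase_subset _ _)) subset_rfl).spans_inter]
    intro x hx
    simp only [Finset.mem_union, mem_spans, Finset.mem_sdiff, Finset.mem_singleton,
      Finset.mem_erase, Finset.mem_inter] at hx ⊢
    tauto
  have hle := (Finset.card_le_card hsplit).trans (Finset.card_union_le _ _)
  have hpart := Finset.card_inter_add_card_sdiff V' V2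
  by_cases hB : 2 ≤ (V' ∩ V2).card
  · have hspan2 := h2.card_spans_erase_le he2 Finset.inter_subset_right hB
    have hCsub : E1 ∩ E2 ⊆ E1.erase f := fun x hx =>
      Finset.mem_erase.2 ⟨fun h => hfC (h ▸ hx), Finset.mem_of_mem_inter_left hx⟩
    have hspan1 := h1.card_spans_sdiff_le hf1 hcommon hCsub Finset.inter_subset_left
      (Finset.inter_subset_right : V' ∩ V1 ⊆ V1)
    have hsub : (V' ∩ V1) \ (V1 ∩ V2) ⊆ V' \ V2 := by
      intro x hx
      simp only [Finset.mem_sdiff, Finset.mem_inter] at hx ⊢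
      tauto
    have := Finset.card_le_card hsub
    omega
  · rw [(hg2.mono (Finset.erase_subset e _) subset_rfl).spans_eq_empty (by omega),
      Finset.card_empty] at hle
    have hmono : (spans (E1.erase f \ (E1 ∩ E2)) (V' ∩ V1)).card ≤
        (spans (E1.erase f) (V' ∩ V1)).card :=
      Finset.card_le_card (spans_subset_spans Finset.sdiff_subset subset_rfl)
    have hAV : (V' ∩ V1).card ≤ V'.card := Finset.card_le_card Finset.inter_subset_left
    by_cases hA : 2 ≤ (V' ∩ V1).card
    · have := h1.card_spans_erase_le hf1 Finset.inter_subset_right hA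
      omega
    · rw [(hg1.mono (Finset.erase_subset f _) subset_rfl).spans_eq_empty (by omega),
        Finset.card_empty] at hmono
      omega

end
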